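/- Let d ≥ 3, let w be a doubly infinite transient trajectory in ℤ^d, and let n₀ < … < n_J be cut-times of w with n_{j+1} − n_j ≥ 2 for j = 0,…,J−1. If for some integer h ≥ 2 one has diam(𝒰_j) ≤ h for all j = 0,…,J−1, then fill({w(l) : n₀ < l < n_J}) is (3h)-avoidable. -/

import Mathlib

/-- Points of `ℤ^d`. -/
abbrev Pt (d : ℕ) := Fin d → ℤ

namespace RI

variable {d : ℕ}

/-- `l¹` distance between two points (ℕ-valued). -/
def n1 (x y : Pt d) : ℕ := ∑ j, (x j - y j).natAbs

/-- `l∞` distance between two points (ℕ-valued). -/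
def ninf (x y : Pt d) : ℕ := Finset.univ.sup fun j => (x j - y j).natAbs

/-- nearest-neighbor adjacency: `‖x - y‖₁ = 1` -/
def adj (x y : Pt d) : Prop := n1 x y = 1

/-- `*`-adjacency: `‖x - y‖_∞ = 1` -/
def adjStar (x y : Pt d) : Prop := ninf x y = 1

/-- `τ` is a nearest-neighbor path of length `N`. -/
def IsPath (τ : ℕ → Pt d) (N : ℕ) : Prop := ∀ l < N, adj (τ l) (τ (l + 1))

/-- the range of a path of length `N` -/
def pathRange (τ : ℕ → Pt d) (N : ℕ) : Set (Pt d) := τ '' {l | l ≤ N}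

/-- `x` and `y` are joined by a nearest-neighbor path all of whose points lie in `U`. -/
def ConnIn (U : Set (Pt d)) (x y : Pt d) : Prop :=
  ∃ τ N, IsPath τ N ∧ τ 0 = x ∧ τ N = y ∧ ∀ l ≤ N, τ l ∈ U

/-- a set is connected: any two of its points are joined by a path inside it -/
def ConnSet (A : Set (Pt d)) : Prop := ∀ x ∈ A, ∀ y ∈ A, ConnIn A x y

/-- the connected component of `U` containing `x` -/
def comp (U : Set (Pt d)) (x : Pt d) : Set (Pt d) := {y | ConnIn U x y}

/-- the (outer) boundary `∂K` -/
def bd (K : Set (Pt d)) : Set (Pt d) := {x | x ∉ K ∧ ∃ y ∈ K, adj x y}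

/-- the `*`-boundary `∂*K` -/
def bdStar (K : Set (Pt d)) : Set (Pt d) := {x | x ∉ K ∧ ∃ y ∈ K, adjStar x y}

/-- the interior boundary `∂_int K` -/
def intBd (K : Set (Pt d)) : Set (Pt d) := {x | x ∈ K ∧ ∃ y, y ∉ K ∧ adj x y}

/-- the `l∞` diameter of a set, valued in `ℕ∞` -/
noncomputable def diam (K : Set (Pt d)) : ℕ∞ := ⨆ x ∈ K, ⨆ y ∈ K, (ninf x y : ℕ∞)

/-- the `l¹` distance between `K` and `K'` exceeds `1` -/
def far1 (K K' : Set (Pt d)) : Prop := ∀ x ∈ K, ∀ y ∈ K', 1 < n1 x y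

/-- the `l∞` distance between `K` and `K'` exceeds `1` -/
def farInf (K K' : Set (Pt d)) : Prop := ∀ x ∈ K, ∀ y ∈ K', 1 < ninf x y

/-- `d_∞(K, K') ≤ r` -/
def dInfLE (K K' : Set (Pt d)) (r : ℕ) : Prop := ∃ x ∈ K, ∃ y ∈ K', ninf x y ≤ r

/-- `fill A`: the set of points every connected set around which inside `Aᶜ` is finite;
for `d ≥ 2` and finite `A` this is exactly the complement of the unique infinite
connected component of `Aᶜ`. -/
def fill (A : Set (Pt d)) : Set (Pt d) :=
  {z | ∀ S : Set (Pt d), z ∈ S → S ⊆ Aᶜ → ConnSet S → S.Finite}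

/-- `A₁` and `A₂` are separated by `𝒰` in `B`: `d(A₁,A₂) > 1` and every path in `B`
joining `∂A₁` to `∂A₂` meets `𝒰`. -/
def SeparatedBy (A₁ A₂ 𝒰 B : Set (Pt d)) : Prop :=
  far1 A₁ A₂ ∧
  ∀ τ N, IsPath τ N → (∀ l ≤ N, τ l ∈ B) → τ 0 ∈ bd A₁ → τ N ∈ bd A₂ →
    ∃ l ≤ N, τ l ∈ 𝒰

/-- the scales `L_κ = L₀ (80 L)^κ` -/
def Lscale (L L₀ κ : ℕ) : ℕ := L₀ * (80 * L) ^ κ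

/-- the box `C_{(κ,i)} = (i L_κ + [0, L_κ)^d) ∩ ℤ^d` -/
def boxC (L L₀ κ : ℕ) (i : Pt d) : Set (Pt d) :=
  {x | ∀ j, i j * (Lscale L L₀ κ : ℤ) ≤ x j ∧
    x j < i j * (Lscale L L₀ κ : ℤ) + (Lscale L L₀ κ : ℤ)}

/-- the neighborhood `C_{(κ,i)}^l = ⋃_{‖j‖_∞ < l} C_{(κ, i+j)}` -/
def boxCl (L L₀ κ : ℕ) (i : Pt d) (l : ℕ) : Set (Pt d) :=
  ⋃ j ∈ {j : Pt d | ∀ t, (j t).natAbs < l}, boxC L L₀ κ (i + j)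

/-- the separation event `χ_{(κ,i)}(𝒰) = 1`: there are connected sets
`A₁, A₂ ⊆ C_{(κ,i)}^2` of diameter at least `L_κ / 2` separated by `𝒰` in `C_{(κ,i)}^3` -/
def chi (L L₀ κ : ℕ) (i : Pt d) (𝒰 : Set (Pt d)) : Prop :=
  ∃ A₁ A₂ : Set (Pt d), A₁ ⊆ boxCl L L₀ κ i 2 ∧ A₂ ⊆ boxCl L L₀ κ i 2 ∧
    ConnSet A₁ ∧ ConnSet A₂ ∧
    (Lscale L L₀ κ : ℕ∞) ≤ 2 * diam A₁ ∧ (Lscale L L₀ κ : ℕ∞) ≤ 2 * diam A₂ ∧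
    SeparatedBy A₁ A₂ 𝒰 (boxCl L L₀ κ i 3)

/-- the centered boxes `C^l = [-(l-1)L₀, l L₀)^d ∩ ℤ^d` -/
def boxCen (L₀ l : ℕ) : Set (Pt d) :=
  {x | ∀ j, -(((l : ℤ) - 1) * (L₀ : ℤ)) ≤ x j ∧ x j < (l : ℤ) * (L₀ : ℤ)}

/-- the separation event `χ(𝒰) = 1` for the centered boxes -/
def chi0 (L₀ : ℕ) (𝒰 : Set (Pt d)) : Prop :=
  ∃ A₁ A₂ : Set (Pt d), A₁ ⊆ boxCen L₀ 2 ∧ A₂ ⊆ boxCen L₀ 2 ∧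
    ConnSet A₁ ∧ ConnSet A₂ ∧
    (L₀ : ℕ∞) ≤ 2 * diam A₁ ∧ (L₀ : ℕ∞) ≤ 2 * diam A₂ ∧
    SeparatedBy A₁ A₂ 𝒰 (boxCen L₀ 3)

/-- `A` is `h`-avoidable in `C`: every path in `C` with endpoints outside `A` can be
modified, within `l∞` distance `h` of its range and through `Range(τ) ∪ ∂*A`,
into a path with the same endpoints avoiding `A`. -/
def Avoidable (h : ℝ) (A C : Set (Pt d)) : Prop :=
  ∀ τ N, IsPath τ N → (∀ l ≤ N, τ l ∈ C) → τ 0 ∉ A → τ N ∉ A →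
    ∃ τ' N', IsPath τ' N' ∧ τ' 0 = τ 0 ∧ τ' N' = τ N ∧
      (∀ l ≤ N', τ' l ∉ A) ∧
      (∀ l ≤ N', (∃ k ≤ N, (ninf (τ' l) (τ k) : ℝ) ≤ h) ∧
        (τ' l ∈ pathRange τ N ∨ τ' l ∈ bdStar A))

/-- a doubly infinite transient nearest-neighbor trajectory -/
def IsTraj (w : ℤ → Pt d) : Prop :=
  (∀ l : ℤ, adj (w l) (w (l + 1))) ∧
  Filter.Tendsto (fun l : ℤ => n1 (w l) 0) Filter.cofinite Filter.atTop

/-- `k` is a cut-time of `w`: `d_∞({w(l) : l < k}, {w(l) : l > k}) > 1` -/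
def CutTime (w : ℤ → Pt d) (k : ℤ) : Prop :=
  ∀ l, l < k → ∀ l', k < l' → 1 < ninf (w l) (w l')

/-- the `j`-th sausage `𝒰_j = {w(l) : n_j < l < n_{j+1}}` -/
def sausage (w : ℤ → Pt d) (n : ℕ → ℤ) (j : ℕ) : Set (Pt d) :=
  w '' {l | n j < l ∧ l < n (j + 1)}

/-- boxes: products of integer intervals -/
def IsBox (B : Set (Pt d)) : Prop :=
  ∃ a b : Pt d, B = {x | ∀ j, a j ≤ x j ∧ x j ≤ b j}

/-- the smallest box containing `K` -/
def sbox (K : Set (Pt d)) : Set (Pt d) := ⋂₀ {B | IsBox B ∧ K ⊆ B}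

/-- the closed `l∞` ball `B(x, r)` -/
def ball (x : Pt d) (r : ℕ) : Set (Pt d) := {y | ninf x y ≤ r}

/-- a skeleton: a set of indices at the finest scale satisfying the Wiener-type
spacing conditions -/
def IsSkeleton (L L₀ : ℕ) (M : Finset (Pt d)) : Prop :=
  ∀ m₀ ∈ M,
    (∀ h : ℕ,
      {m : Pt d | m ∈ M ∧
        dInfLE (boxC L L₀ 0 m₀) (boxC L L₀ 0 m) (L * Lscale L L₀ (h + 1)) ∧
        ¬ dInfLE (boxC L L₀ 0 m₀) (boxC L L₀ 0 m) (L * Lscale L L₀ h)}.ncard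
        ≤ 2 ^ (h + 1)) ∧
    ∀ m ∈ M, m ≠ m₀ → ¬ dInfLE (boxC L L₀ 0 m₀) (boxC L L₀ 0 m) (L * Lscale L L₀ 0)

/-! ### Distances and adjacency -/

lemma ninf_le_iff {x y : Pt d} {r : ℕ} : ninf x y ≤ r ↔ ∀ i, (x i - y i).natAbs ≤ r := by
  simp [ninf]

lemma ninf_comm (x y : Pt d) : ninf x y = ninf y x := by
  unfold ninf
  congr 1
  funext i
  omega

lemma ninf_eq_zero {x y : Pt d} (h : ninf x y = 0) : x = y := by
  have := (ninf_le_iff (x := x) (y := y)).1 h.le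
  funext i
  have := this i
  omega

lemma ninf_self (x : Pt d) : ninf x x = 0 :=
  Nat.le_zero.1 (ninf_le_iff.2 fun i => by simp)

lemma ninf_triangle (x y z : Pt d) : ninf x z ≤ ninf x y + ninf y z := by
  rw [ninf_le_iff]
  intro i
  have h1 := (ninf_le_iff (x := x) (y := y)).1 le_rfl i
  have h2 := (ninf_le_iff (x := y) (y := z)).1 le_rfl i
  omega

lemma adj_comm {x y : Pt d} : adj x y ↔ adj y x := by
  unfold adj n1
  simp_rw [fun j => show (x j - y j).natAbs = (y j - x j).natAbs by omega]

lemma adj_add_single (x : Pt d) (i : Fin d) : adj x (x + Pi.single i 1) := by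
  unfold adj n1
  rw [Finset.sum_eq_single i] <;> simp +contextual

lemma adj_iff {x y : Pt d} :
    adj x y ↔ ∃ i, y = x + Pi.single i 1 ∨ x = y + Pi.single i 1 := by
  constructor
  · intro h
    have hne : ∃ i, x i ≠ y i := by
      by_contra! hc
      simp [adj, n1, hc] at h
    obtain ⟨i, hi⟩ := hne
    unfold adj n1 at h
    rw [← Finset.add_sum_erase _ _ (Finset.mem_univ i)] at h
    have h0 : ∑ j ∈ Finset.univ.erase i, (x j - y j).natAbs = 0 := by omega
    rw [Finset.sum_eq_zero_iff] at h0
    have hj : ∀ j, j ≠ i → x j = y j := fun j hj => by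
      have := h0 j (by simp [hj])
      omega
    refine ⟨i, ?_⟩
    rcases (show y i = x i + 1 ∨ x i = y i + 1 by omega) with h1 | h1
    · left
      funext j
      by_cases hji : j = i
      · subst hji; simpa using h1
      · simp [hji, hj j hji]
    · right
      funext j
      by_cases hji : j = i
      · subst hji; simpa using h1
      · simp [hji, hj j hji]
  · rintro ⟨i, rfl | rfl⟩
    · exact adj_add_single x i
    · exact adj_comm.1 (adj_add_single y i)

lemma adj.ninf_le {x y : Pt d} (h : adj x y) : ninf x y ≤ 1 := by
  rw [ninf_le_iff]
  intro i
  calc (x i - y i).natAbs ≤ n1 x y :=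
        Finset.single_le_sum (f := fun i => (x i - y i).natAbs) (fun _ _ => Nat.zero_le _)
          (Finset.mem_univ i)
    _ = 1 := h

lemma adj.ne {x y : Pt d} (h : adj x y) : x ≠ y := by
  rintro rfl
  simp [adj, n1] at h

lemma adjStar_of_le {x y : Pt d} (h : ninf x y ≤ 1) (hne : x ≠ y) : adjStar x y := by
  have : ninf x y ≠ 0 := fun h0 => hne (ninf_eq_zero h0)
  unfold adjStar
  omega

/-! ### Connections inside a set -/

lemma connIn_iff {U : Set (Pt d)} {x y : Pt d} :
    ConnIn U x y ↔ x ∈ U ∧ Relation.ReflTransGen (fun a b => adj a b ∧ b ∈ U) x y := by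
  constructor
  · rintro ⟨τ, N, hτ, rfl, rfl, hU⟩
    refine ⟨hU 0 (Nat.zero_le _), ?_⟩
    suffices H : ∀ l ≤ N, Relation.ReflTransGen (fun a b => adj a b ∧ b ∈ U) (τ 0) (τ l) from
      H N le_rfl
    intro l
    induction l with
    | zero => exact fun _ => .refl
    | succ l ih => exact fun hl => (ih (by omega)).tail ⟨hτ l (by omega), hU _ hl⟩
  · rintro ⟨hx, h⟩
    induction h with
    | refl => exact ⟨fun _ => x, 0, fun l hl => by omega, rfl, rfl, fun _ _ => hx⟩
    | @tail b c _ hbc ih =>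
      obtain ⟨τ, N, hτ, h0, hN, hU⟩ := ih
      refine ⟨fun l => if l ≤ N then τ l else c, N + 1, fun l hl => ?_, by simp [h0], by simp,
        fun l _ => ?_⟩
      · rcases Nat.lt_succ_iff_lt_or_eq.1 hl with h1 | rfl
        · simpa [h1.le, Nat.succ_le_of_lt h1] using hτ l h1
        · simpa [hN] using hbc.1
      · by_cases h1 : l ≤ N
        · simpa [h1] using hU l h1
        · simpa [h1] using hbc.2

namespace ConnIn

variable {U S : Set (Pt d)} {x y z : Pt d}

lemma refl (hx : x ∈ U) : ConnIn U x x := connIn_iff.2 ⟨hx, .refl⟩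

lemma mem_left (h : ConnIn U x y) : x ∈ U := (connIn_iff.1 h).1

lemma tail (h : ConnIn U x y) (ha : adj y z) (hz : z ∈ U) : ConnIn U x z :=
  connIn_iff.2 ⟨h.mem_left, (connIn_iff.1 h).2.tail ⟨ha, hz⟩⟩

/-- Induction along a connection, from its starting point. -/
lemma induct {P : Pt d → Prop} (h : ConnIn U x y) (h0 : P x)
    (hs : ∀ a b, ConnIn U x a → P a → adj a b → b ∈ U → P b) : P y := by
  obtain ⟨hx, h⟩ := connIn_iff.1 h
  induction h with
  | refl => exact h0
  | tail hab hbc ih =>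
    have hxb := connIn_iff.2 ⟨hx, hab⟩
    exact hs _ _ hxb (ih hxb) hbc.1 hbc.2

lemma mem_right (h : ConnIn U x y) : y ∈ U :=
  h.induct h.mem_left fun _ _ _ _ _ hb => hb

lemma trans (h : ConnIn U x y) (h' : ConnIn U y z) : ConnIn U x z :=
  h'.induct h fun _ _ _ hp ha hb => hp.tail ha hb

lemma of_adj (hx : x ∈ U) (hy : y ∈ U) (h : adj x y) : ConnIn U x y := (refl hx).tail h hy

lemma symm (h : ConnIn U x y) : ConnIn U y x :=
  h.induct (P := fun y => ConnIn U y x) (refl h.mem_left) fun _ _ hxa hp ha hb =>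
    (of_adj hb hxa.mem_right (adj_comm.1 ha)).trans hp

lemma in_comp (h : ConnIn U x y) : ConnIn (comp U x) x y :=
  h.induct (refl (refl h.mem_left)) fun _ _ hxa hp ha hb => hp.tail ha (hxa.tail ha hb)

lemma mono (h : ConnIn U x y) (hUS : U ⊆ S) : ConnIn S x y :=
  h.induct (refl (hUS h.mem_left)) fun _ _ _ hp ha hb => hp.tail ha (hUS hb)

/-- A connection entering `A` has a first entrance. -/
lemma exists_entrance {A : Set (Pt d)} (h : ConnIn S x y) (hx : x ∉ A) (hy : y ∈ A) :
    ∃ p q, ConnIn (S \ A) x p ∧ adj p q ∧ q ∈ S ∧ q ∈ A := by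
  by_contra! hc
  refine (h.induct (P := fun z => ConnIn (S \ A) x z) (refl ⟨h.mem_left, hx⟩) ?_).mem_right.2 hy
  intro a b _ hp hab hb
  exact hp.tail hab ⟨hb, hc a b hp hab hb⟩

/-- A path through obstacles `W` can be rerouted through connected shells around them, where
`shell a Q` says that `Q` is the shell of the obstacle at `a`. -/
lemma bypass {T W G : Set (Pt d)} {shell : Pt d → Set (Pt d) → Prop}
    (h : ConnIn T x y) (hx : x ∉ W) (hy : y ∉ W)
    (hTG : ∀ a ∈ T, a ∉ W → a ∈ G)
    (hW : ∀ a Q, shell a Q → a ∈ W)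
    (hex : ∀ a ∈ T, a ∈ W → ∃ Q, shell a Q)
    (hQ : ∀ a ∈ T, ∀ Q, shell a Q → ConnSet Q ∧ Q ⊆ G)
    (hout : ∀ a Q b, shell a Q → adj a b → b ∉ W → b ∈ Q)
    (hin : ∀ a Q b Q', shell a Q → shell b Q' → adj a b → (Q ∩ Q').Nonempty) :
    ConnIn G x y := by
  suffices H : (y ∉ W → ConnIn G x y) ∧ ∀ Q, shell y Q → ∀ r ∈ Q, ConnIn G x r from H.1 hy
  refine h.induct (P := fun y => (y ∉ W → ConnIn G x y) ∧
    ∀ Q, shell y Q → ∀ r ∈ Q, ConnIn G x r) ?_ ?_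
  · exact ⟨fun _ => refl (hTG x h.mem_left hx), fun Q hq => absurd (hW _ _ hq) hx⟩
  · intro a b hxa ⟨ih₁, ih₂⟩ hab hbT
    refine ⟨fun hb => ?_, fun Q hq r hr => ?_⟩
    · by_cases ha : a ∈ W
      · obtain ⟨Q, hq⟩ := hex a hxa.mem_right ha
        exact ih₂ Q hq b (hout a Q b hq hab hb)
      · exact (ih₁ ha).tail hab (hTG b hbT hb)
    · obtain ⟨hconn, hsub⟩ := hQ b hbT Q hq
      by_cases ha : a ∈ W
      · obtain ⟨Q', hq'⟩ := hex a hxa.mem_right ha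
        obtain ⟨s, hs', hs⟩ := hin a Q' b Q hq' hq hab
        exact (ih₂ Q' hq' s hs').trans ((hconn s hs r hr).mono hsub)
      · have haQ := hout b Q a hq (adj_comm.1 hab) ha
        exact (ih₁ ha).trans ((hconn a haQ r hr).mono hsub)

end ConnIn

/-- the box spanned by two points -/
def hull (x y : Pt d) : Set (Pt d) :=
  {z | ∀ i, min (x i) (y i) ≤ z i ∧ z i ≤ max (x i) (y i)}

lemma connIn_hull (x y : Pt d) : ConnIn (hull x y) x y := by
  induction hm : n1 x y generalizing x with
  | zero =>
    have : x = y := by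
      funext i
      have := (Finset.sum_eq_zero_iff.1 hm) i (Finset.mem_univ i)
      omega
    subst this
    exact .refl fun i => by simp
  | succ m ih =>
    have hne : ∃ i, x i ≠ y i := by
      by_contra! hc
      simp [n1, hc] at hm
    obtain ⟨i, hi⟩ := hne
    obtain ⟨x', hx', hadj, hdec⟩ : ∃ x' : Pt d, (∀ j, j ≠ i → x' j = x j) ∧ adj x x' ∧
        (x i < x' i ∧ x' i ≤ y i ∧ x' i = x i + 1 ∨
          x' i < x i ∧ y i ≤ x' i ∧ x' i = x i - 1) := by
      rcases lt_or_gt_of_ne hi with h | h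
      · refine ⟨x + Pi.single i 1, fun j hj => by simp [hj], adj_add_single x i, Or.inl ?_⟩
        simp
        omega
      · refine ⟨x - Pi.single i 1, fun j hj => by simp [hj], ?_, Or.inr ?_⟩
        · exact adj_iff.2 ⟨i, Or.inr (by simp)⟩
        · simp
          omega
    have hn : n1 x' y = m := by
      unfold n1 at hm ⊢
      rw [← Finset.add_sum_erase _ _ (Finset.mem_univ i)] at hm ⊢
      have : ∑ j ∈ Finset.univ.erase i, (x' j - y j).natAbs =
          ∑ j ∈ Finset.univ.erase i, (x j - y j).natAbs :=
        Finset.sum_congr rfl fun j hj => by rw [hx' j (Finset.ne_of_mem_erase hj)]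
      omega
    have hsub : hull x' y ⊆ hull x y := fun z hz j => by
      have := hz j
      by_cases hj : j = i
      · subst hj; omega
      · rw [hx' j hj] at this; exact this
    have h := (ih x' hn).mono hsub
    exact (ConnIn.of_adj (fun j => by omega) h.mem_left hadj).trans h

lemma connIn_of_hull {S : Set (Pt d)} {x y : Pt d} (h : hull x y ⊆ S) : ConnIn S x y :=
  (connIn_hull x y).mono h

lemma ninf_le_of_mem_hull {x y a b : Pt d} (ha : a ∈ hull x y) (hb : b ∈ hull x y) :
    ninf a b ≤ ninf x y := by
  rw [ninf_le_iff]
  intro i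
  have := (ninf_le_iff (x := x) (y := y)).1 le_rfl i
  have := ha i
  have := hb i
  omega

lemma right_mem_hull (x y : Pt d) : y ∈ hull x y := fun i => by omega

/-! ### Connectedness of the `*`-boundary -/

lemma exists_int_primitive {G : Type*} [AddCommGroup G] (φ : ℤ → G) :
    ∃ Φ : ℤ → G, ∀ t, Φ (t + 1) = Φ t + φ t := by
  refine ⟨fun t => ∑ s ∈ Finset.Ico 0 t, φ s - ∑ s ∈ Finset.Ico t 0, φ s, fun t => ?_⟩
  rcases le_or_gt 0 t with ht | ht
  · have h1 : Finset.Ico 0 (t + 1) = insert t (Finset.Ico 0 t) := by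
      ext s; simp; omega
    simp [h1, Finset.Ico_eq_empty_of_le ht, Finset.Ico_eq_empty_of_le (show 0 ≤ t + 1 by omega),
      add_comm]
  · have h1 : Finset.Ico t 0 = insert t (Finset.Ico (t + 1) 0) := by
      ext s; simp; omega
    simp [h1, Finset.Ico_eq_empty_of_le ht.le, Finset.Ico_eq_empty_of_le (show t + 1 ≤ 0 by omega)]

/-- A function on the edges of `ℤ^d` whose sum around every unit square vanishes is a gradient. -/
lemma exists_potential {G : Type*} [AddCommGroup G] (f : Pt d → Fin d → G)
    (hf : ∀ x i j, f x i + f (x + Pi.single i 1) j = f x j + f (x + Pi.single j 1) i) :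
    ∃ g : Pt d → G, ∀ x i, g (x + Pi.single i 1) = g x + f x i := by
  suffices H : ∀ s : Finset (Fin d), ∃ g : Pt d → G, ∀ x, ∀ i ∈ s,
      g (x + Pi.single i 1) = g x + f x i by
    obtain ⟨g, hg⟩ := H Finset.univ
    exact ⟨g, fun x i => hg x i (Finset.mem_univ i)⟩
  intro s
  induction s using Finset.induction_on with
  | empty => exact ⟨0, by simp⟩
  | insert k s hk ih =>
    obtain ⟨g, hg⟩ := ih
    choose P hP using exists_int_primitive (G := G)
    set r : Pt d → G := fun x => f x k - g (x + Pi.single k 1) + g x with hr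
    have hinv : ∀ x, ∀ i ∈ s, r (x + Pi.single i 1) = r x := by
      intro x i hi
      have h1 := hg (x + Pi.single k 1) i hi
      rw [add_right_comm] at h1
      have h2 := eq_sub_of_add_eq' (hf x i k)
      simp only [hr, h1, hg x i hi, h2]
      abel
    refine ⟨fun x => g x + P (fun t => r (Function.update x k t)) (x k), fun x i hi => ?_⟩
    rcases Finset.mem_insert.1 hi with rfl | hi
    · have h1 : ∀ t, Function.update (x + Pi.single i 1) i t = Function.update x i t := by
        intro t
        funext j
        by_cases hj : j = i
        · subst hj; simp
        · simp [hj]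
      simp only [h1, Pi.add_apply, Pi.single_eq_same, hP, Function.update_eq_self, hr]
      abel
    · have hik : i ≠ k := fun h => hk (h ▸ hi)
      have h1 : ∀ t, Function.update (x + Pi.single i 1) k t
          = Function.update x k t + Pi.single i 1 := by
        intro t
        funext j
        by_cases hj : j = k
        · subst hj; simp [hik.symm]
        · simp [hj]
      simp only [h1, hinv _ i hi, Pi.add_apply, Pi.single_eq_of_ne hik.symm, add_zero, hg x i hi]
      abel

lemma exists_entrance_of_mem_bdStar {A : Set (Pt d)} {b : Pt d} (hb : b ∈ bdStar A) :
    ∃ p a, ConnIn (bdStar A) b p ∧ adj p a ∧ a ∈ A := by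
  obtain ⟨hbA, a, ha, hba⟩ := hb
  obtain ⟨p, q, hp, hpq, -, hq⟩ := (connIn_hull b a).exists_entrance hbA ha
  refine ⟨p, q, hp.mono ?_, hpq, hq⟩
  rintro z ⟨hz, hzA⟩
  refine ⟨hzA, a, ha, adjStar_of_le ?_ (fun h => hzA (h ▸ ha))⟩
  exact (ninf_le_of_mem_hull hz (right_mem_hull b a)).trans hba.le

open scoped Classical in
/-- Parity of the number of edges joining `A` to `B` around a square, where `aᵢ` and `bᵢ` say that
the `i`-th corner lies in `A` and in `B` respectively. -/
lemma square_parity {a₁ a₂ a₃ a₄ b₁ b₂ b₃ b₄ : Prop}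
    (d₁ : b₁ → ¬a₁) (d₂ : b₂ → ¬a₂) (d₃ : b₃ → ¬a₃) (d₄ : b₄ → ¬a₄)
    (e₁ : b₁ → a₃ ∨ a₄ → a₂ ∨ b₂) (e₂ : b₁ → a₂ ∨ a₄ → a₃ ∨ b₃)
    (e₃ : b₂ → a₃ ∨ a₄ → a₁ ∨ b₁) (e₄ : b₂ → a₁ ∨ a₃ → a₄ ∨ b₄)
    (e₅ : b₃ → a₂ ∨ a₄ → a₁ ∨ b₁) (e₆ : b₃ → a₁ ∨ a₂ → a₄ ∨ b₄)
    (e₇ : b₄ → a₁ ∨ a₃ → a₂ ∨ b₂) (e₈ : b₄ → a₁ ∨ a₂ → a₃ ∨ b₃) :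
    (if a₁ ∧ b₂ ∨ b₁ ∧ a₂ then 1 else 0 : ZMod 2) + (if a₂ ∧ b₄ ∨ b₂ ∧ a₄ then 1 else 0) =
      (if a₁ ∧ b₃ ∨ b₁ ∧ a₃ then 1 else 0) + (if a₃ ∧ b₄ ∨ b₃ ∧ a₄ then 1 else 0) := by
  have two : (1 : ZMod 2) + 1 = 0 := by decide
  by_cases a₁ <;> by_cases a₂ <;> by_cases a₃ <;> by_cases a₄ <;>
    by_cases b₁ <;> by_cases b₂ <;> by_cases b₃ <;> by_cases b₄ <;> simp_all

/-- If `A` and its complement are connected, then so is the `*`-boundary of `A`. -/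
theorem connSet_bdStar {A : Set (Pt d)} (hA : ConnSet A) (hAc : ConnSet Aᶜ) :
    ConnSet (bdStar A) := by
  classical
  intro b₁ hb₁ b₂ hb₂
  by_contra hcon
  set B : Set (Pt d) := comp (bdStar A) b₁ with hB
  have hBA : ∀ x ∈ B, x ∉ A := fun x hx => (ConnIn.mem_right hx).1
  have hnbr : ∀ r p q : Pt d, r ∈ A → p ∈ B → q ∉ A → adj p q → ninf q r ≤ 1 → q ∈ B := by
    intro r p q hr hp hq hpq hqr
    exact ConnIn.tail hp hpq ⟨hq, r, hr, adjStar_of_le hqr fun h => hq (h ▸ hr)⟩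
  let F : Pt d → Pt d → ZMod 2 := fun x y => if x ∈ A ∧ y ∈ B ∨ x ∈ B ∧ y ∈ A then 1 else 0
  have hFsymm : ∀ x y, F x y = F y x := fun x y => by
    simp only [F]
    congr 1
    apply propext
    tauto
  obtain ⟨g, hg⟩ := exists_potential (fun x i => F x (x + Pi.single i 1)) (by
    intro x i j
    by_cases hij : i = j
    · subst hij; rfl
    set p := x + Pi.single i 1 with hp
    set q := x + Pi.single j 1 with hq
    have hpr : p + Pi.single j 1 = q + Pi.single i 1 := add_right_comm _ _ _
    set r := q + Pi.single i 1 with hr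
    have h1 : adj x p := adj_add_single x i
    have h2 : adj x q := adj_add_single x j
    have h3 : adj q r := adj_add_single q i
    have h4 : adj p r := hpr ▸ adj_add_single p j
    have hxr : ninf x r ≤ 1 := by
      rw [ninf_le_iff]
      intro k
      simp only [hr, hq, Pi.add_apply, Pi.single_apply]
      split_ifs <;> simp_all
    have hpq : ninf p q ≤ 1 := by
      rw [ninf_le_iff]
      intro k
      simp only [hp, hq, Pi.add_apply, Pi.single_apply]
      split_ifs <;> simp
    have n1 := h1.ninf_le
    have n2 := h2.ninf_le
    have n3 := h3.ninf_le
    have n4 := h4.ninf_le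
    have m1 := ninf_comm x p ▸ n1
    have m2 := ninf_comm x q ▸ n2
    have m3 := ninf_comm q r ▸ n3
    have m4 := ninf_comm p r ▸ n4
    have m5 := ninf_comm x r ▸ hxr
    have m6 := ninf_comm p q ▸ hpq
    have k1 := adj_comm.1 h1
    have k2 := adj_comm.1 h2
    have k3 := adj_comm.1 h3
    have k4 := adj_comm.1 h4
    rw [hpr]
    have key : ∀ u v s t : Pt d, adj u v → ninf v s ≤ 1 → ninf v t ≤ 1 → u ∈ B →
        (s ∈ A ∨ t ∈ A) → v ∈ A ∨ v ∈ B := by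
      intro u v s t huv hvs hvt hu hst
      by_cases hv : v ∈ A
      · exact Or.inl hv
      · exact Or.inr (hst.elim (fun h => hnbr s u v h hu hv huv hvs)
          fun h => hnbr t u v h hu hv huv hvt)
    exact square_parity (hBA x) (hBA p) (hBA q) (hBA r) (key x p q r h1 hpq n4)
      (key x q p r h2 m6 n3) (key p x q r k1 n2 hxr) (key p r x q h4 m5 m3)
      (key q x p r k2 n1 hxr) (key q r x p h3 m5 m4) (key r p x q k4 m1 hpq)
      (key r q x p k3 m2 m6))
  have hgF : ∀ x y, adj x y → g y = g x + F x y := by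
    intro x y hxy
    obtain ⟨i, rfl | rfl⟩ := adj_iff.1 hxy
    · exact hg x i
    · rw [hg y i, hFsymm, add_assoc, CharTwo.add_self_eq_zero, add_zero]
  have hconst : ∀ S : Set (Pt d), (∀ x ∈ S, ∀ y ∈ S, F x y = 0) → ConnSet S →
      ∀ x ∈ S, ∀ y ∈ S, g x = g y := by
    intro S hS hconn x hx y hy
    refine (hconn x hx y hy).induct (P := fun y => g x = g y) rfl ?_
    intro a b hxa hp hab hb
    rw [hgF a b hab, hS a hxa.mem_right b hb, add_zero, hp]
  have hgA := hconst A (fun x hx y hy => by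
    have h1 : x ∉ B := fun h => hBA x h hx
    have h2 : y ∉ B := fun h => hBA y h hy
    simp [F, h1, h2]) hA
  have hgAc := hconst Aᶜ (fun x hx y hy => by
    have h1 : x ∉ A := hx
    have h2 : y ∉ A := hy
    simp [F, h1, h2]) hAc
  obtain ⟨p, a, hp, hpa, ha⟩ := exists_entrance_of_mem_bdStar hb₁
  obtain ⟨q, c, hq, hqc, hc⟩ := exists_entrance_of_mem_bdStar hb₂
  have hqB : q ∉ B := fun h => hcon (ConnIn.trans h hq.symm)
  have hpB : p ∈ B := hp
  have h1 := hgF p a hpa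
  have h2 := hgF q c hqc
  have hqA : q ∉ A := hq.mem_right.1
  rw [hgA a ha c hc, h2, hgAc p (hBA p hpB) q hqA] at h1
  simp [F, hqB, hqA, hpB, ha] at h1

/-! ### Filled sets -/

lemma mem_fill_iff {U : Set (Pt d)} {z : Pt d} : z ∈ fill U ↔ (comp Uᶜ z).Finite := by
  constructor
  · intro hz
    by_cases hzU : z ∈ U
    · convert Set.finite_empty
      exact Set.eq_empty_of_forall_notMem fun y hy => (ConnIn.mem_left hy) hzU
    · refine hz _ (ConnIn.refl hzU) (fun y hy => ConnIn.mem_right hy) ?_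
      intro x hx y hy
      exact hx.in_comp.symm.trans hy.in_comp
  · intro hfin S hzS hSU hS
    exact hfin.subset fun y hy => (hS z hzS y hy).mono hSU

lemma subset_fill (U : Set (Pt d)) : U ⊆ fill U :=
  fun _ hz _ hzS hSU _ => absurd hz (hSU hzS)

lemma fill_mono {U V : Set (Pt d)} (h : U ⊆ V) : fill U ⊆ fill V :=
  fun _ hz S hzS hSV hS => hz S hzS (hSV.trans (Set.compl_subset_compl.2 h)) hS

lemma notMem_fill_of_connIn {U : Set (Pt d)} {x y : Pt d} (h : ConnIn Uᶜ x y)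
    (hx : x ∉ fill U) : y ∉ fill U := by
  rw [mem_fill_iff] at hx ⊢
  exact fun hfin => hx (hfin.subset fun z hz => h.symm.trans hz)

/-- A connection from inside `fill U` to its outside meets `U`. -/
lemma exists_mem_of_connIn_fill {U S : Set (Pt d)} {x y : Pt d} (h : ConnIn S x y)
    (hx : x ∈ fill U) (hy : y ∉ fill U) : ∃ p ∈ S, p ∈ U := by
  by_contra! hc
  exact notMem_fill_of_connIn (h.symm.mono hc) hy hx

lemma bounds_of_mem_hull_update {x : Pt d} {i : Fin d} {t : ℤ} {z : Pt d}
    (hz : z ∈ hull x (Function.update x i t)) :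
    min (x i) t ≤ z i ∧ z i ≤ max (x i) t := by
  simpa using hz i

lemma eq_of_mem_hull {x y z : Pt d} {i : Fin d} (hz : z ∈ hull x y) (h : x i = y i) :
    z i = x i := by
  have := hz i
  omega

lemma infinite_comp_of_update {U : Set (Pt d)} {x : Pt d} {i : Fin d} {T : Set ℤ}
    (hT : T.Infinite) (h : ∀ t ∈ T, ConnIn U x (Function.update x i t)) :
    (comp U x).Infinite := by
  refine (hT.image (f := fun t => Function.update x i t)
    (Function.update_injective x i).injOn).mono ?_
  rintro _ ⟨t, ht, rfl⟩
  exact h t ht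

lemma exists_le_of_mem_fill {U : Set (Pt d)} {x : Pt d} (hx : x ∈ fill U) (i : Fin d) :
    (∃ u ∈ U, u i ≤ x i) ∧ ∃ u ∈ U, x i ≤ u i := by
  rw [mem_fill_iff] at hx
  constructor
  · by_contra! hc
    refine infinite_comp_of_update (i := i) (Set.Iic_infinite (x i)) (fun t ht => ?_) hx
    refine connIn_of_hull fun z hz hzU => ?_
    have := bounds_of_mem_hull_update hz
    have := hc z hzU
    have : t ≤ x i := ht
    omega
  · by_contra! hc
    refine infinite_comp_of_update (i := i) (Set.Ici_infinite (x i)) (fun t ht => ?_) hx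
    refine connIn_of_hull fun z hz hzU => ?_
    have := bounds_of_mem_hull_update hz
    have := hc z hzU
    have : x i ≤ t := ht
    omega

lemma fill_subset_Icc {U : Set (Pt d)} {a b : Pt d} (h : U ⊆ Set.Icc a b) :
    fill U ⊆ Set.Icc a b := by
  intro x hx
  refine ⟨fun i => ?_, fun i => ?_⟩
  · obtain ⟨u, hu, hui⟩ := (exists_le_of_mem_fill hx i).1
    exact ((h hu).1 i).trans hui
  · obtain ⟨u, hu, hui⟩ := (exists_le_of_mem_fill hx i).2
    exact hui.trans ((h hu).2 i)

lemma exists_subset_Icc {U : Set (Pt d)} (hU : U.Finite) : ∃ a b, U ⊆ Set.Icc a b := by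
  obtain ⟨a, ha⟩ := hU.bddBelow
  obtain ⟨b, hb⟩ := hU.bddAbove
  exact ⟨a, b, fun x hx => ⟨ha hx, hb hx⟩⟩

lemma finite_fill {U : Set (Pt d)} (hU : U.Finite) : (fill U).Finite := by
  obtain ⟨a, b, h⟩ := exists_subset_Icc hU
  exact (Set.finite_Icc a b).subset (fill_subset_Icc h)

lemma ninf_le_of_mem_fill {U : Set (Pt d)} {h : ℕ} (hU : ∀ u ∈ U, ∀ v ∈ U, ninf u v ≤ h)
    {x y : Pt d} (hx : x ∈ fill U) (hy : y ∈ fill U) : ninf x y ≤ h := by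
  rw [ninf_le_iff]
  intro i
  obtain ⟨⟨u, hu, hui⟩, u', hu', hui'⟩ := exists_le_of_mem_fill hx i
  obtain ⟨⟨v, hv, hvi⟩, v', hv', hvi'⟩ := exists_le_of_mem_fill hy i
  have h1 := ninf_le_iff.1 (hU u hu v' hv') i
  have h2 := ninf_le_iff.1 (hU u' hu' v hv) i
  omega

lemma connSet_fill (hd : 0 < d) {U : Set (Pt d)} (hU : U.Finite) (hconn : ConnSet U) :
    ConnSet (fill U) := by
  obtain ⟨a, b, hab⟩ := exists_subset_Icc hU
  have hc : b + 1 ∉ fill U := fun h => by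
    have := (fill_subset_Icc hab h).2 ⟨0, hd⟩
    simp at this
  have key : ∀ z ∈ fill U, ∃ u ∈ U, ConnIn (fill U) z u := by
    intro z hz
    obtain ⟨p, q, hp, hpq, -, hq⟩ := (connIn_hull z (b + 1)).exists_entrance
      (A := (fill U)ᶜ) (fun h => h hz) hc
    have hpf : p ∈ fill U := not_not.1 hp.mem_right.2
    refine ⟨p, ?_, hp.mono fun y hy => not_not.1 hy.2⟩
    by_contra hpU
    exact hq ((not_imp_not.1 (notMem_fill_of_connIn
      (ConnIn.of_adj (U := Uᶜ) (fun h => hq (subset_fill U h)) hpU (adj_comm.1 hpq)))) hpf)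
  intro x hx y hy
  obtain ⟨u, hu, hxu⟩ := key x hx
  obtain ⟨v, hv, hyv⟩ := key y hy
  exact (hxu.trans ((hconn u hu v hv).mono (subset_fill U))).trans hyv.symm

lemma connSet_compl_fill (hd : 2 ≤ d) {U : Set (Pt d)} (hU : U.Finite) :
    ConnSet (fill U)ᶜ := by
  obtain ⟨a, b, hab⟩ := exists_subset_Icc hU
  have hout : ∀ x y : Pt d, ∀ i, x i = y i → (x i < a i ∨ b i < x i) → ConnIn Uᶜ x y := by
    intro x y i hxy hi
    refine connIn_of_hull fun z hz hzU => ?_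
    have h1 : a i ≤ z i := (hab hzU).1 i
    have h2 : z i ≤ b i := (hab hzU).2 i
    have := eq_of_mem_hull hz hxy
    omega
  have key : ∀ z ∉ fill U, ConnIn Uᶜ z (b + 1) := by
    intro z hz
    rw [mem_fill_iff] at hz
    obtain ⟨x, hx, hxab⟩ := (Set.Infinite.sdiff hz (Set.finite_Icc a b)).nonempty
    obtain ⟨i, hi⟩ : ∃ i, x i < a i ∨ b i < x i := by
      by_contra! hc
      exact hxab ⟨fun i => (hc i).1, fun i => (hc i).2⟩
    have : Nontrivial (Fin d) := Fin.nontrivial_iff_two_le.2 hd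
    obtain ⟨k, hk⟩ := exists_ne i
    refine (ConnIn.trans hx (hout x (Function.update x k (b k + 1)) i (by simp [hk.symm]) hi)).trans
      (hout _ _ k (by simp) (Or.inr (by simp)))
  intro x hx y hy
  have h := (key x hx).trans (key y hy).symm
  exact h.in_comp.mono fun z hz => notMem_fill_of_connIn hz hx

/-- In dimension at least two, the `*`-boundary of a filled finite connected set is connected. -/
theorem connSet_bdStar_fill (hd : 2 ≤ d) {U : Set (Pt d)} (hU : U.Finite) (hconn : ConnSet U) :
    ConnSet (bdStar (fill U)) :=
  connSet_bdStar (connSet_fill (by omega) hU hconn) (connSet_compl_fill hd hU)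

/-! ### Rings around a point in a coordinate hyperplane -/

/-- the `*`-neighbors of `x` in the hyperplane through `x` orthogonal to the `i`-th axis -/
def ring (x : Pt d) (i : Fin d) : Set (Pt d) := {z | z i = x i ∧ adjStar z x}

lemma connSet_ring (hd : 3 ≤ d) (x : Pt d) (i : Fin d) : ConnSet (ring x i) := by
  have hcoord : ∀ z ∈ ring x i, ∃ a, a ≠ i ∧ (z a - x a).natAbs = 1 := by
    rintro z ⟨hzi, hz⟩
    by_contra! hc
    have h0 : ninf z x ≤ 0 := by
      rw [ninf_le_iff]
      intro a
      have h1 := ninf_le_iff.1 (le_of_eq hz) a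
      by_cases ha : a = i
      · subst ha; omega
      · have := hc a ha; omega
    have : ninf z x = 1 := hz
    omega
  have hmem : ∀ z : Pt d, z i = x i → ninf z x ≤ 1 → ∀ a, (z a - x a).natAbs = 1 →
      z ∈ ring x i := by
    intro z hzi hz a ha
    refine ⟨hzi, adjStar_of_le hz ?_⟩
    rintro rfl
    simp at ha
  have hsame : ∀ z ∈ ring x i, ∀ z' ∈ ring x i, ∀ a, z a = z' a → (z a - x a).natAbs = 1 →
      ConnIn (ring x i) z z' := by
    intro z hz z' hz' a hzz' ha
    refine connIn_of_hull fun y hy => hmem y ?_ ?_ a ?_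
    · rw [eq_of_mem_hull hy (hz.1.trans hz'.1.symm), hz.1]
    · rw [ninf_le_iff]
      intro k
      have h1 := ninf_le_iff.1 (le_of_eq hz.2) k
      have h2 := ninf_le_iff.1 (le_of_eq hz'.2) k
      have := hy k
      omega
    · rw [eq_of_mem_hull hy hzz', ha]
  have hupd : ∀ z ∈ ring x i, ∀ b, b ≠ i → ∀ t : ℤ, (t - x b).natAbs = 1 →
      Function.update z b t ∈ ring x i := by
    intro z hz b hb t ht
    refine hmem _ (by simp [hb.symm, hz.1]) ?_ b (by simpa using ht)
    rw [ninf_le_iff]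
    intro k
    by_cases hk : k = b
    · subst hk; simp [ht]
    · simpa [hk] using ninf_le_iff.1 (le_of_eq hz.2) k
  have hdiff : ∀ z ∈ ring x i, ∀ z' ∈ ring x i, ∀ a b, a ≠ b → b ≠ i →
      (z a - x a).natAbs = 1 → (z' b - x b).natAbs = 1 → ConnIn (ring x i) z z' := by
    intro z hz z' hz' a b hab hb ha hb'
    have hm := hupd z hz b hb (z' b) hb'
    refine (hsame z hz _ hm a (by simp [hab]) ha).trans (hsame _ hm z' hz' b (by simp) ?_)
    simpa using hb'
  intro z hz z' hz'
  obtain ⟨a, hai, ha⟩ := hcoord z hz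
  obtain ⟨b, hbi, hb⟩ := hcoord z' hz'
  by_cases hab : a = b
  · subst hab
    obtain ⟨c, hc⟩ : ∃ c, c ∉ ({i, a} : Finset (Fin d)) := by
      by_contra! hc
      have h1 := Finset.card_le_card (fun c _ => hc c : (Finset.univ : Finset (Fin d)) ⊆ {i, a})
      have h2 := Finset.card_le_two (a := i) (b := a)
      simp at h1
      omega
    simp only [Finset.mem_insert, Finset.mem_singleton, not_or] at hc
    have hm := hupd z hz c hc.1 (x c + 1) (by simp)
    exact (hsame z hz _ hm a (by simp [Ne.symm hc.2]) ha).trans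
      (hdiff _ hm z' hz' c a hc.2 hbi (by simp) hb)
  · exact hdiff z hz z' hz' a b hab hbi ha hb

/-- the `*`-neighbors of `x` within `l∞` distance one of both `y` and `v` -/
def collar (y x v : Pt d) : Set (Pt d) := {z | adjStar z x ∧ ninf z y ≤ 1 ∧ ninf z v ≤ 1}

/-- If `x` lies between two neighbors at `l∞` distance more than one, then its collar is a ring
and contains the other neighbors of `x`. -/
lemma exists_collar_eq_ring {x y y' : Pt d} (h : adj x y) (h' : adj x y')
    (hfar : 1 < ninf y y') :
    ∃ i, collar y x y' = ring x i ∧ ∀ p, adj x p → p ≠ y → p ≠ y' → p ∈ ring x i := by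
  obtain ⟨k, hk⟩ : ∃ k, 1 < (y k - y' k).natAbs := by
    by_contra! hc
    exact absurd (ninf_le_iff.2 hc) (by omega)
  have hax : ∀ p, adj x p → ∀ a, p a ≠ x a → (p a - x a).natAbs = 1 ∧ ∀ j, j ≠ a → p j = x j := by
    intro p hp a ha
    obtain ⟨i, rfl | rfl⟩ := adj_iff.1 hp
    · have hai : a = i := by
        by_contra hne
        simp [hne] at ha
      subst hai
      exact ⟨by simp, fun j hj => by simp [hj]⟩
    · have hai : a = i := by
        by_contra hne
        simp [hne] at ha
      subst hai
      exact ⟨by simp, fun j hj => by simp [hj]⟩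
  have b1 := ninf_le_iff.1 h.ninf_le k
  have b2 := ninf_le_iff.1 h'.ninf_le k
  obtain ⟨c1, c2⟩ := hax y h k (by omega)
  obtain ⟨c3, c4⟩ := hax y' h' k (by omega)
  refine ⟨k, Set.Subset.antisymm (fun z hz => ⟨?_, hz.1⟩) fun z hz => ?_,
    fun p hp hpy hpy' => ?_⟩
  · have h1 := ninf_le_iff.1 hz.2.1 k
    have h2 := ninf_le_iff.1 hz.2.2 k
    omega
  · refine ⟨hz.2, ?_, ?_⟩ <;>
    · rw [ninf_le_iff]
      intro j
      have h1 := ninf_le_iff.1 (le_of_eq hz.2) j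
      have h2 := hz.1
      by_cases hj : j = k
      · subst hj; omega
      · have := c2 j hj
        have := c4 j hj
        omega
  · refine ⟨?_, adjStar_of_le ?_ hp.ne.symm⟩
    · by_contra hne
      obtain ⟨e1, e2⟩ := hax p hp k hne
      rcases (show p k = y k ∨ p k = y' k by omega) with h1 | h1
      · refine hpy (funext fun j => ?_)
        by_cases hj : j = k
        · subst hj; exact h1
        · rw [e2 j hj, c2 j hj]
      · refine hpy' (funext fun j => ?_)
        by_cases hj : j = k
        · subst hj; exact h1
        · rw [e2 j hj, c4 j hj]
    · exact ninf_comm x p ▸ hp.ninf_le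

/-! ### Trajectories and cut-times -/

lemma IsTraj.infinite_image {w : ℤ → Pt d} (hw : IsTraj w) {T : Set ℤ} (hT : T.Infinite) :
    (w '' T).Infinite := by
  intro hfin
  obtain ⟨M, hM⟩ := (hfin.image fun x => n1 x 0).bddAbove
  have h := hw.2.eventually (Filter.eventually_gt_atTop M)
  rw [Filter.eventually_cofinite] at h
  refine hT (h.subset fun l hl => not_lt.2 (hM ⟨w l, ⟨l, hl, rfl⟩, rfl⟩))

lemma IsTraj.connIn {w : ℤ → Pt d} (hw : IsTraj w) {S : Set (Pt d)} {a b : ℤ} (hab : a ≤ b)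
    (hS : ∀ l, a ≤ l → l ≤ b → w l ∈ S) : ConnIn S (w a) (w b) := by
  induction b, hab using Int.leInduction with
  | base => exact .refl (hS a le_rfl le_rfl)
  | succ b hab ih =>
    exact (ih fun l h1 h2 => hS l h1 (by omega)).tail (hw.1 b) (hS _ (by omega) le_rfl)

lemma CutTime.ne {w : ℤ → Pt d} (hw : IsTraj w) {k : ℤ} (hk : CutTime w k) {l : ℤ} (hl : l ≠ k) :
    w l ≠ w k := by
  intro h
  rcases lt_or_gt_of_ne hl with hl | hl
  · have h1 := hk l hl (k + 1) (by omega)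
    have h2 := (hw.1 k).ninf_le
    rw [h] at h1
    omega
  · have h1 := hk (k - 1) (by omega) l hl
    have h2 := (hw.1 (k - 1)).ninf_le
    rw [h] at h1
    simp only [sub_add_cancel] at h2
    omega

/-- Times `n₀ < … < n_J` that are pairwise non-adjacent cut-times of the trajectory `w`. -/
structure CutChain (w : ℤ → Pt d) (n : ℕ → ℤ) (J : ℕ) : Prop where
  traj : IsTraj w
  gap : ∀ j < J, n j + 2 ≤ n (j + 1)
  cut : ∀ j ≤ J, CutTime w (n j)

/-- the filled sausages together with the points at the intermediate cut-times -/
def filledChain (w : ℤ → Pt d) (n : ℕ → ℤ) (J : ℕ) : Set (Pt d) :=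
  {z | (∃ j < J, z ∈ fill (sausage w n j)) ∨ ∃ k, 0 < k ∧ k < J ∧ z = w (n k)}

/-- the collar around the point of the trajectory `w` at time `k` -/
def cutCollar (w : ℤ → Pt d) (k : ℤ) : Set (Pt d) := collar (w (k + 1)) (w k) (w (k - 1))

/-- the part of the `*`-boundary of the `j`-th filled sausage outside the chain -/
def sausageShell (w : ℤ → Pt d) (n : ℕ → ℤ) (J j : ℕ) : Set (Pt d) :=
  bdStar (fill (sausage w n j)) \ filledChain w n J

lemma finite_sausage (w : ℤ → Pt d) (n : ℕ → ℤ) (j : ℕ) : (sausage w n j).Finite :=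
  (Set.finite_Ioo (n j) (n (j + 1))).image w

lemma sausage_subset_filledChain (w : ℤ → Pt d) (n : ℕ → ℤ) {J j : ℕ} (hj : j < J) :
    sausage w n j ⊆ filledChain w n J :=
  fun _ hz => Or.inl ⟨j, hj, subset_fill _ hz⟩

lemma image_subset_filledChain (w : ℤ → Pt d) (n : ℕ → ℤ) (J : ℕ) :
    w '' {l | n 0 < l ∧ l < n J} ⊆ filledChain w n J := by
  rintro _ ⟨l, ⟨hl, hl'⟩, rfl⟩
  suffices key : ∀ m ≤ J, l < n m → w l ∈ filledChain w n J from key J le_rfl hl'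
  intro m
  induction m with
  | zero => intro _ h; omega
  | succ m ih =>
    intro hm hlm
    rcases lt_trichotomy l (n m) with h | rfl | h
    · exact ih (by omega) h
    · refine Or.inr ⟨m, Nat.pos_of_ne_zero ?_, hm, rfl⟩
      rintro rfl
      exact lt_irrefl _ hl
    · exact sausage_subset_filledChain w n hm ⟨l, ⟨h, hlm⟩, rfl⟩

lemma finite_filledChain (w : ℤ → Pt d) (n : ℕ → ℤ) (J : ℕ) : (filledChain w n J).Finite := by
  have h1 : (⋃ j ∈ Finset.range J, fill (sausage w n j)).Finite :=
    Set.Finite.biUnion (Finset.finite_toSet _) fun j _ => finite_fill (finite_sausage w n j)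
  have h2 : ((fun k => w (n k)) '' Set.Iio J).Finite := (Set.finite_Iio J).image _
  refine (h1.union h2).subset ?_
  rintro z (⟨j, hj, hz⟩ | ⟨k, -, hk, rfl⟩)
  · exact Or.inl (by simpa using ⟨j, hj, hz⟩)
  · exact Or.inr ⟨k, hk, rfl⟩

namespace CutChain

variable {w : ℤ → Pt d} {n : ℕ → ℤ} {J : ℕ}

lemma add_two_le (H : CutChain w n J) {i j : ℕ} (hij : i < j) (hj : j ≤ J) : n i + 2 ≤ n j := by
  induction j, hij using Nat.le_induction with
  | base => exact H.gap i hj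
  | succ j hij ih =>
    have h1 := ih (by omega)
    have h2 := H.gap j (by omega)
    omega

lemma le (H : CutChain w n J) {i j : ℕ} (hij : i ≤ j) (hj : j ≤ J) : n i ≤ n j := by
  rcases hij.eq_or_lt with rfl | h
  · exact le_rfl
  · have := H.add_two_le h hj
    omega

lemma succ_mem_sausage (H : CutChain w n J) {j : ℕ} (hj : j < J) :
    w (n j + 1) ∈ sausage w n j :=
  ⟨_, ⟨by omega, by have := H.gap j hj; omega⟩, rfl⟩

lemma pred_mem_sausage (H : CutChain w n J) {j : ℕ} (hj : j < J) :
    w (n (j + 1) - 1) ∈ sausage w n j :=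
  ⟨_, ⟨by have := H.gap j hj; omega, by omega⟩, rfl⟩

lemma connSet_sausage (H : CutChain w n J) (j : ℕ) : ConnSet (sausage w n j) := by
  have key : ∀ a b, n j < a → a ≤ b → b < n (j + 1) → ConnIn (sausage w n j) (w a) (w b) :=
    fun a b ha hab hb => H.traj.connIn hab fun l h1 h2 => ⟨l, ⟨by omega, by omega⟩, rfl⟩
  rintro _ ⟨a, ⟨ha, ha'⟩, rfl⟩ _ ⟨b, ⟨hb, hb'⟩, rfl⟩
  rcases le_total a b with h | h
  · exact key a b ha h hb'
  · exact (key b a hb h ha').symm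

lemma notMem_fill (H : CutChain w n J) {j : ℕ} (hj : j < J) {l : ℤ}
    (hl : l ≤ n j ∨ n (j + 1) ≤ l) : w l ∉ fill (sausage w n j) := by
  have hout : ∀ m, m ≤ n j ∨ n (j + 1) ≤ m → w m ∈ (sausage w n j)ᶜ := by
    rintro m hm ⟨m', ⟨h1, h2⟩, he⟩
    have hc1 := H.cut j (by omega)
    have hc2 := H.cut (j + 1) (by omega)
    rcases hm with hm | hm <;> rcases hm.eq_or_lt with rfl | hm
    · exact hc1.ne H.traj (by omega) he
    · have := hc1 m hm m' h1
      rw [he, ninf_self] at this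
      omega
    · exact hc2.ne H.traj (by omega) he
    · have := hc2 m' h2 m hm
      rw [he, ninf_self] at this
      omega
  rw [mem_fill_iff]
  rcases hl with hl | hl
  · refine ((H.traj.infinite_image (Set.Iic_infinite l)).mono ?_)
    rintro _ ⟨m, hm, rfl⟩
    have hm : m ≤ l := hm
    exact (H.traj.connIn hm fun k _ h2 => hout k (Or.inl (by omega))).symm
  · refine ((H.traj.infinite_image (Set.Ici_infinite l)).mono ?_)
    rintro _ ⟨m, hm, rfl⟩
    exact H.traj.connIn hm fun k h1 _ => hout k (Or.inr (by omega))

lemma cutPoint_notMem_fill (H : CutChain w n J) {j k : ℕ} (hj : j < J) (hk : k ≤ J) :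
    w (n k) ∉ fill (sausage w n j) := by
  refine H.notMem_fill hj ?_
  rcases le_or_gt k j with h | h
  · exact Or.inl (H.le h (by omega))
  · exact Or.inr (H.le h hk)

lemma sausage_far (H : CutChain w n J) {j k : ℕ} (hj : j < J) (hk : k < J) (hjk : j ≠ k)
    {u v : Pt d} (hu : u ∈ sausage w n j) (hv : v ∈ sausage w n k) : 1 < ninf u v := by
  obtain ⟨a, ⟨ha, ha'⟩, rfl⟩ := hu
  obtain ⟨b, ⟨hb, hb'⟩, rfl⟩ := hv
  rcases lt_or_gt_of_ne hjk with h | h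
  · have := H.le (show j + 1 ≤ k from h) hk.le
    exact H.cut (j + 1) hj a ha' b (by omega)
  · have := H.le (show k + 1 ≤ j from h) hj.le
    rw [ninf_comm]
    exact H.cut (k + 1) hk b hb' a (by omega)

lemma disjoint_sausage_fill (H : CutChain w n J) {j k : ℕ} (hj : j < J) (hk : k < J)
    (hjk : j ≠ k) : ∀ z ∈ sausage w n k, z ∉ fill (sausage w n j) := by
  rintro _ ⟨b, ⟨hb, hb'⟩, rfl⟩
  refine H.notMem_fill hj ?_
  rcases lt_or_gt_of_ne hjk with h | h
  · have := H.le (show j + 1 ≤ k from h) hk.le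
    exact Or.inr (by omega)
  · have := H.le (show k + 1 ≤ j from h) hj.le
    exact Or.inl (by omega)

lemma disjoint_fill (H : CutChain w n J) (hd : 0 < d) {j k : ℕ} (hj : j < J) (hk : k < J)
    (hjk : j ≠ k) {z : Pt d} (hzj : z ∈ fill (sausage w n j)) : z ∉ fill (sausage w n k) := by
  intro hzk
  have hu := H.succ_mem_sausage hj
  have hconn := connSet_fill hd (finite_sausage w n j) (H.connSet_sausage j) z hzj _
    (subset_fill _ hu)
  obtain ⟨p, hp, hpk⟩ := exists_mem_of_connIn_fill hconn hzk
    (H.disjoint_sausage_fill hk hj hjk.symm _ hu)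
  exact H.disjoint_sausage_fill hj hk hjk p hpk hp

lemma fill_far (H : CutChain w n J) (hd : 0 < d) {j k : ℕ} (hj : j < J) (hk : k < J)
    (hjk : j ≠ k) {x y : Pt d} (hx : x ∈ fill (sausage w n j)) (hy : y ∈ fill (sausage w n k)) :
    1 < ninf x y := by
  by_contra! hxy
  obtain ⟨p, hp, hpj⟩ := exists_mem_of_connIn_fill (connIn_hull x y) hx
    (H.disjoint_fill hd hk hj hjk.symm hy)
  obtain ⟨q, hq, hqk⟩ := exists_mem_of_connIn_fill (connIn_hull x y).symm hy
    (H.disjoint_fill hd hj hk hjk hx)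
  have h1 := H.sausage_far hj hk hjk hpj hqk
  have h2 := ninf_le_of_mem_hull hp hq
  omega

lemma eq_of_fill_near_cutPoint (H : CutChain w n J) {j k : ℕ} (hj : j < J) (hk : k ≤ J)
    {x : Pt d} (hx : x ∈ fill (sausage w n j)) (hxk : ninf x (w (n k)) ≤ 1) :
    k = j ∨ k = j + 1 := by
  by_contra! hne
  obtain ⟨p, hp, a, ⟨ha, ha'⟩, rfl⟩ := exists_mem_of_connIn_fill (connIn_hull x (w (n k))) hx
    (H.cutPoint_notMem_fill hj hk)
  have h1 := ninf_le_of_mem_hull hp (right_mem_hull x (w (n k)))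
  rcases lt_or_ge k j with h | h
  · have h2 := H.add_two_le h hj.le
    have := H.cut j hj.le (n k) (by omega) a ha
    rw [ninf_comm] at this
    omega
  · have h2 := H.add_two_le (show j + 1 < k by omega) hk
    have := H.cut (j + 1) hj a ha' (n k) (by omega)
    omega

lemma adj_pred (H : CutChain w n J) (k : ℤ) : adj (w k) (w (k - 1)) := by
  have := H.traj.1 (k - 1)
  rw [sub_add_cancel] at this
  exact adj_comm.1 this

lemma cut_nbrs_far (H : CutChain w n J) {k : ℕ} (hk : k ≤ J) :
    1 < ninf (w (n k + 1)) (w (n k - 1)) := by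
  rw [ninf_comm]
  exact H.cut k hk _ (by omega) _ (by omega)

lemma connSet_cutCollar (H : CutChain w n J) (hd : 3 ≤ d) {k : ℕ} (hk : k ≤ J) :
    ConnSet (cutCollar w (n k)) := by
  obtain ⟨i, hi, -⟩ := exists_collar_eq_ring (H.traj.1 (n k)) (H.adj_pred (n k)) (H.cut_nbrs_far hk)
  rw [cutCollar, hi]
  exact connSet_ring hd _ i

lemma adj_cutPoint (H : CutChain w n J) {k : ℕ} (hk : k ≤ J) {p : Pt d} (hp : adj (w (n k)) p) :
    p = w (n k + 1) ∨ p = w (n k - 1) ∨ p ∈ cutCollar w (n k) := by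
  obtain ⟨i, hi, h⟩ := exists_collar_eq_ring (H.traj.1 (n k)) (H.adj_pred (n k)) (H.cut_nbrs_far hk)
  rw [cutCollar, hi]
  by_contra! hc
  exact hc.2.2 (h p hp hc.1 hc.2.1)

lemma cutCollar_ne (H : CutChain w n J) {k : ℕ} (hk : k ≤ J) {z : Pt d}
    (hz : z ∈ cutCollar w (n k)) (l : ℤ) : z ≠ w l := by
  rintro rfl
  obtain ⟨h1, h2, h3⟩ := hz
  rcases lt_trichotomy l (n k) with h | rfl | h
  · have := H.cut k hk l h (n k + 1) (by omega)
    omega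
  · have h1 : ninf (w (n k)) (w (n k)) = 1 := h1
    rw [ninf_self] at h1
    omega
  · have := H.cut k hk (n k - 1) (by omega) l h
    rw [ninf_comm] at this
    omega

lemma cutCollar_notMem_fill (H : CutChain w n J) {j k : ℕ} (hj : j < J) (hk : k ≤ J) {z : Pt d}
    (hz : z ∈ cutCollar w (n k)) : z ∉ fill (sausage w n j) := by
  intro hzf
  have hx := H.cutPoint_notMem_fill hj hk
  obtain ⟨p, hp, hpU⟩ := exists_mem_of_connIn_fill (connIn_hull z (w (n k))) hzf hx
  have hpx : p ≠ w (n k) := fun h => hx (subset_fill _ (h ▸ hpU))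
  have hbox : ∀ y, ninf z y ≤ 1 → ninf (w (n k)) y ≤ 1 → ninf p y ≤ 1 := by
    intro y h1 h2
    rw [ninf_le_iff] at h1 h2 ⊢
    intro i
    have := h1 i
    have := h2 i
    have := hp i
    omega
  have hpc : p ∈ cutCollar w (n k) :=
    ⟨adjStar_of_le (hbox _ (le_of_eq hz.1) (by rw [ninf_self]; omega)) hpx,
      hbox _ hz.2.1 (H.traj.1 _).ninf_le, hbox _ hz.2.2 (H.adj_pred _).ninf_le⟩
  obtain ⟨a, -, rfl⟩ := hpU
  exact H.cutCollar_ne hk hpc a rfl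

lemma cutCollar_notMem (H : CutChain w n J) {k : ℕ} (hk : k ≤ J) {z : Pt d}
    (hz : z ∈ cutCollar w (n k)) : z ∉ filledChain w n J := by
  rintro (⟨j, hj, hzf⟩ | ⟨k', -, -, rfl⟩)
  · exact H.cutCollar_notMem_fill hj hk hz hzf
  · exact H.cutCollar_ne hk hz _ rfl

lemma cutCollar_subset_sausageShell (H : CutChain w n J) {j k : ℕ} (hj : j < J) (hk : k < J)
    (hjk : k = j ∨ k = j + 1) : cutCollar w (n k) ⊆ sausageShell w n J j := by
  intro z hz
  refine ⟨⟨H.cutCollar_notMem_fill hj hk.le hz, ?_⟩, H.cutCollar_notMem hk.le hz⟩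
  rcases hjk with rfl | rfl
  · exact ⟨_, subset_fill _ (H.succ_mem_sausage hj),
      adjStar_of_le hz.2.1 (H.cutCollar_ne hk.le hz _)⟩
  · exact ⟨_, subset_fill _ (H.pred_mem_sausage hj),
      adjStar_of_le hz.2.2 (H.cutCollar_ne hk.le hz _)⟩

lemma mem_cutCollar_of_adj (H : CutChain w n J) {k : ℕ} (h0 : 0 < k) (hk : k < J) {p : Pt d}
    (hp : adj (w (n k)) p) (hpW : p ∉ filledChain w n J) : p ∈ cutCollar w (n k) := by
  obtain ⟨k, rfl⟩ := Nat.exists_eq_succ_of_ne_zero h0.ne'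
  rcases H.adj_cutPoint hk.le hp with rfl | rfl | h
  · exact absurd (sausage_subset_filledChain w n hk (H.succ_mem_sausage hk)) hpW
  · exact absurd (sausage_subset_filledChain w n (by omega)
      (H.pred_mem_sausage (by omega : k < J))) hpW
  · exact h

lemma not_adj_cutPoints (H : CutChain w n J) {k k' : ℕ} (hk : k ≤ J) (hk' : k' ≤ J) :
    ¬adj (w (n k)) (w (n k')) := by
  intro hadj
  have hne : k ≠ k' := fun h => hadj.ne (by rw [h])
  have hgap : n k + 2 ≤ n k' ∨ n k' + 2 ≤ n k := by
    rcases lt_or_gt_of_ne hne with h | h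
    · exact Or.inl (H.add_two_le h hk')
    · exact Or.inr (H.add_two_le h hk)
  rcases H.adj_cutPoint hk hadj with h | h | h
  · exact (H.cut k' hk').ne H.traj (l := n k + 1) (by omega) h.symm
  · exact (H.cut k' hk').ne H.traj (l := n k - 1) (by omega) h.symm
  · exact H.cutCollar_ne hk h _ rfl

lemma connSet_sausageShell (H : CutChain w n J) (hd : 3 ≤ d) {j : ℕ} (hj : j < J) :
    ConnSet (sausageShell w n J j) := by
  intro p hp q hq
  have hconn := connSet_bdStar_fill (by omega) (finite_sausage w n j) (H.connSet_sausage j)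
    p hp.1 q hq.1
  refine hconn.bypass (W := filledChain w n J) (shell := fun a Q => ∃ k, 0 < k ∧ k < J ∧
    (k = j ∨ k = j + 1) ∧ a = w (n k) ∧ Q = cutCollar w (n k)) hp.2 hq.2
    (fun a ha haW => ⟨ha, haW⟩) ?_ ?_ ?_ ?_ ?_
  · rintro a Q ⟨k, h0, hk, -, rfl, -⟩
    exact Or.inr ⟨k, h0, hk, rfl⟩
  · rintro a ⟨haj, y, hy, hay⟩ (⟨k, hk, hak⟩ | ⟨k, h0, hk, rfl⟩)
    · have hjk : k ≠ j := fun h => haj (h ▸ hak)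
      have h1 := H.fill_far (by omega) hk hj hjk hak hy
      have h2 : ninf a y = 1 := hay
      omega
    · refine ⟨_, k, h0, hk, H.eq_of_fill_near_cutPoint hj hk.le hy ?_, rfl, rfl⟩
      rw [ninf_comm]
      exact le_of_eq hay
  · rintro a - Q ⟨k, h0, hk, hjk, rfl, rfl⟩
    exact ⟨H.connSet_cutCollar hd hk.le, H.cutCollar_subset_sausageShell hj hk hjk⟩
  · rintro a Q b ⟨k, h0, hk, hjk, rfl, rfl⟩ hab hb
    exact H.mem_cutCollar_of_adj h0 hk hab hb
  · rintro a Q b Q' ⟨k, h0, hk, hjk, rfl, rfl⟩ ⟨k', h0', hk', hjk', rfl, rfl⟩ hab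
    exact absurd hab (H.not_adj_cutPoints hk.le hk'.le)

lemma nonempty_cutCollar (H : CutChain w n J) (hd : 3 ≤ d) {k : ℕ} (hk : k ≤ J) :
    (cutCollar w (n k)).Nonempty := by
  obtain ⟨i, hi, -⟩ := exists_collar_eq_ring (H.traj.1 (n k)) (H.adj_pred (n k)) (H.cut_nbrs_far hk)
  have : Nontrivial (Fin d) := Fin.nontrivial_iff_two_le.2 (by omega)
  obtain ⟨a, ha⟩ := exists_ne i
  rw [cutCollar, hi]
  have hadj := adj_add_single (w (n k)) a
  exact ⟨w (n k) + Pi.single a 1, by simp [ha.symm],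
    adjStar_of_le (ninf_comm (w (n k)) _ ▸ hadj.ninf_le) hadj.ne.symm⟩

/-- A connection whose endpoints avoid the filled chain can be rerouted around the chain, using
the shells of the sausages and cut-points that it meets. -/
lemma connIn_bypass (H : CutChain w n J) (hd : 3 ≤ d) {T G : Set (Pt d)} {x y : Pt d}
    (h : ConnIn T x y) (hx : x ∉ filledChain w n J) (hy : y ∉ filledChain w n J)
    (hTG : ∀ a ∈ T, a ∉ filledChain w n J → a ∈ G)
    (hsausage : ∀ a ∈ T, ∀ j < J, a ∈ fill (sausage w n j) → sausageShell w n J j ⊆ G)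
    (hcollar : ∀ k, 0 < k → k < J → w (n k) ∈ T → cutCollar w (n k) ⊆ G) :
    ConnIn G x y := by
  refine h.bypass (W := filledChain w n J) (shell := fun a Q =>
    (∃ j < J, a ∈ fill (sausage w n j) ∧ Q = sausageShell w n J j) ∨
    ∃ k, 0 < k ∧ k < J ∧ a = w (n k) ∧ Q = cutCollar w (n k)) hx hy hTG ?_ ?_ ?_ ?_ ?_
  · rintro a Q (⟨j, hj, ha, -⟩ | ⟨k, h0, hk, rfl, -⟩)
    · exact Or.inl ⟨j, hj, ha⟩
    · exact Or.inr ⟨k, h0, hk, rfl⟩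
  · rintro a - (⟨j, hj, ha⟩ | ⟨k, h0, hk, rfl⟩)
    · exact ⟨_, Or.inl ⟨j, hj, ha, rfl⟩⟩
    · exact ⟨_, Or.inr ⟨k, h0, hk, rfl, rfl⟩⟩
  · rintro a haT Q (⟨j, hj, ha, rfl⟩ | ⟨k, h0, hk, rfl, rfl⟩)
    · exact ⟨H.connSet_sausageShell hd hj, hsausage a haT j hj ha⟩
    · exact ⟨H.connSet_cutCollar hd hk.le, hcollar k h0 hk haT⟩
  · rintro a Q b (⟨j, hj, ha, rfl⟩ | ⟨k, h0, hk, rfl, rfl⟩) hab hb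
    · refine ⟨⟨fun h => hb (Or.inl ⟨j, hj, h⟩), a, ha, ?_⟩, hb⟩
      exact adjStar_of_le (ninf_comm a b ▸ hab.ninf_le) hab.ne.symm
    · exact H.mem_cutCollar_of_adj h0 hk hab hb
  · have mixed : ∀ a j k, j < J → k < J → a ∈ fill (sausage w n j) → adj a (w (n k)) →
        (cutCollar w (n k) ∩ sausageShell w n J j).Nonempty := by
      intro a j k hj hk ha hab
      have hjk := H.eq_of_fill_near_cutPoint hj hk.le ha hab.ninf_le
      obtain ⟨z, hz⟩ := H.nonempty_cutCollar hd hk.le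
      exact ⟨z, hz, H.cutCollar_subset_sausageShell hj hk hjk hz⟩
    rintro a Q b Q' (⟨j, hj, ha, rfl⟩ | ⟨k, h0, hk, rfl, rfl⟩)
      (⟨j', hj', hb, rfl⟩ | ⟨k', h0', hk', rfl, rfl⟩) hab
    · have hjj : j = j' := by
        by_contra hne
        have h1 := H.fill_far (by omega) hj hj' hne ha hb
        have h2 := hab.ninf_le
        omega
      subst hjj
      have hne : (cutCollar w (n j)).Nonempty := H.nonempty_cutCollar hd hj.le
      rw [Set.inter_self]
      exact hne.mono (H.cutCollar_subset_sausageShell hj hj (Or.inl rfl))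
    · rw [Set.inter_comm]
      exact mixed a j k' hj hk' ha hab
    · exact mixed b j' k hj' hk hb (adj_comm.1 hab)
    · exact absurd hab (H.not_adj_cutPoints hk.le hk'.le)

lemma fill_eq_filledChain (H : CutChain w n J) (hd : 3 ≤ d) :
    fill (w '' {l | n 0 < l ∧ l < n J}) = filledChain w n J := by
  apply Set.Subset.antisymm
  · intro z hz
    by_contra hzW
    rw [mem_fill_iff] at hz
    have : Nonempty (Fin d) := ⟨⟨0, by omega⟩⟩
    refine (finite_filledChain w n J).infinite_compl (hz.subset fun y hy => ?_)
    refine (H.connIn_bypass hd (T := Set.univ) (G := (filledChain w n J)ᶜ)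
      (connIn_of_hull (Set.subset_univ _)) hzW hy (fun a _ ha => ha) ?_ ?_).mono
      (Set.compl_subset_compl.2 (image_subset_filledChain w n J))
    · exact fun _ _ j _ _ z hz => hz.2
    · exact fun k _ hk _ z hz => H.cutCollar_notMem hk.le hz
  · rintro z (⟨j, hj, hz⟩ | ⟨k, h0, hk, rfl⟩)
    · refine fill_mono (Set.image_mono ?_) hz
      rintro l ⟨h1, h2⟩
      have := H.le (Nat.zero_le j) hj.le
      have := H.le (show j + 1 ≤ J from hj) le_rfl
      exact ⟨by omega, by omega⟩
    · have := H.add_two_le h0 hk.le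
      have := H.add_two_le hk le_rfl
      exact subset_fill _ ⟨n k, ⟨by omega, by omega⟩, rfl⟩

end CutChain

/-- if the sausages between non-adjacent cut-times `n₀ < … < n_J` all have
diameter at most `h`, then `fill({w(l) : n₀ < l < n_J})` is `(3h)`-avoidable. -/
theorem statement9 (d : ℕ) (hd : 3 ≤ d) (w : ℤ → Pt d) (hw : IsTraj w)
    (J : ℕ) (n : ℕ → ℤ)
    (hgap : ∀ j < J, n j + 2 ≤ n (j + 1))
    (hcut : ∀ j ≤ J, CutTime w (n j))
    (h : ℕ) (hh : 2 ≤ h)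
    (hdiam : ∀ j < J, diam (sausage w n j) ≤ (h : ℕ∞)) :
    Avoidable ((3 * h : ℕ) : ℝ) (fill (w '' {l | n 0 < l ∧ l < n J})) Set.univ := by
  have H : CutChain w n J := ⟨hw, hgap, hcut⟩
  have hdiam' : ∀ j < J, ∀ u ∈ sausage w n j, ∀ v ∈ sausage w n j, ninf u v ≤ h := by
    intro j hj u hu v hv
    have h1 : (ninf u v : ℕ∞) ≤ diam (sausage w n j) :=
      le_iSup₂_of_le u hu (le_iSup₂_of_le v hv le_rfl)
    exact_mod_cast h1.trans (hdiam j hj)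
  rw [H.fill_eq_filledChain hd]
  intro τ N hτ _ h0 hN
  let G : Set (Pt d) := {z | z ∉ filledChain w n J ∧ (∃ k ≤ N, ninf z (τ k) ≤ 3 * h) ∧
    (z ∈ pathRange τ N ∨ z ∈ bdStar (filledChain w n J))}
  have hconn : ConnIn G (τ 0) (τ N) := by
    refine H.connIn_bypass hd (T := pathRange τ N)
      ⟨τ, N, hτ, rfl, rfl, fun l hl => ⟨l, hl, rfl⟩⟩ h0 hN ?_ ?_ ?_
    · rintro _ ⟨l, hl, rfl⟩ ha
      exact ⟨ha, ⟨l, hl, by rw [ninf_self]; omega⟩, Or.inl ⟨l, hl, rfl⟩⟩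
    · rintro _ ⟨l, hl, rfl⟩ j hj ha z ⟨⟨-, y, hy, hzy⟩, hzW⟩
      refine ⟨hzW, ⟨l, hl, ?_⟩, Or.inr ⟨hzW, y, Or.inl ⟨j, hj, hy⟩, hzy⟩⟩
      have h1 := ninf_triangle z y (τ l)
      have h2 := ninf_le_of_mem_fill (hdiam' j hj) hy ha
      have h3 : ninf z y = 1 := hzy
      omega
    · rintro k hk0 hk ⟨l, hl, hlk⟩ z hz
      have hzW := H.cutCollar_notMem hk.le hz
      refine ⟨hzW, ⟨l, hl, ?_⟩, Or.inr ⟨hzW, _, Or.inr ⟨k, hk0, hk, rfl⟩, hz.1⟩⟩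
      have h3 : ninf z (w (n k)) = 1 := hz.1
      rw [hlk]
      omega
  obtain ⟨τ', N', hτ', h0', hN', hG⟩ := hconn
  refine ⟨τ', N', hτ', h0', hN', fun l hl => (hG l hl).1, fun l hl => ⟨?_, (hG l hl).2.2⟩⟩
  obtain ⟨k, hk, hkl⟩ := (hG l hl).2.1
  exact ⟨k, hk, by exact_mod_cast hkl⟩

end RI
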